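/- A small groupoid is free if and only if its skeleton is free: for a small groupoid G, Nonempty (IsFreeGroupoid G) ↔ Nonempty (IsFreeGroupoid (Skeleton G)), where Skeleton G (Mathlib's CategoryTheory.Skeleton) carries its induced groupoid structure. -/

import Mathlib

open CategoryTheory

/-- The groupoid structure on the skeleton of a groupoid, induced from the groupoid
structure of `G` (the skeleton being the induced category on a choice of representatives). -/
noncomputable instance skeletonGroupoid (G : Type u) [Groupoid.{u} G] :
    Groupoid (Skeleton G) :=
  InducedCategory.groupoid G Quotient.out

namespace IsFreeGroupoid

section VertexGroup

variable {G : Type u} [Groupoid.{u} G]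

open scoped Classical in
/-- The functor onto a vertex group that conjugates the arrows of its connected component by
chosen arrows from the vertex, and kills all other arrows. -/
noncomputable def toVertexGroup (r : G) : G ⥤ SingleObj (End r) where
  obj _ := SingleObj.star _
  map {a b} g :=
    if h : Nonempty (r ⟶ a) then
      End.of (h.some ≫ g ≫ Groupoid.inv (h.map (· ≫ g)).some)
    else (1 : End r)
  map_id a := by
    split_ifs with h
    · simp only [Category.id_comp, Groupoid.comp_inv]
      rfl
    · rfl
  map_comp {a b c} g k := by
    by_cases h : Nonempty (r ⟶ a)
    · have h' : Nonempty (r ⟶ b) := h.map (· ≫ g)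
      rw [dif_pos h, dif_pos h, dif_pos h', SingleObj.comp_as_mul]
      change _ = (_ ≫ _ : r ⟶ r)
      simp [End.of]
    · have h' : ¬ Nonempty (r ⟶ b) := fun h' => h (h'.map (· ≫ Groupoid.inv g))
      rw [dif_neg h, dif_neg h, dif_neg h', SingleObj.comp_as_mul]
      exact (one_mul (1 : End r)).symm

theorem toVertexGroup_map_injective (r : G) :
    Function.Injective fun g : r ⟶ r => (toVertexGroup r).map g := by
  intro g k h
  have hr : Nonempty (r ⟶ r) := ⟨𝟙 r⟩
  simp only [toVertexGroup, dif_pos hr] at h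
  change (_ ≫ _ : r ⟶ r) = _ ≫ _ at h
  exact (cancel_mono _).1 ((cancel_epi _).1 h)

/-- Every vertex group of a free groupoid is free. -/
theorem isFreeGroup_end [IsFreeGroupoid G] (r : G) : IsFreeGroup (End r) := by
  let E : Type u := Σ a b : Generators G, (a ⟶ b)
  obtain ⟨U, hU, -⟩ := unique_lift (G := G) (X := FreeGroup E)
    (fun a b e => FreeGroup.of ⟨a, b, e⟩)
  let φ : FreeGroup E →* End r :=
    FreeGroup.lift fun e => (toVertexGroup r).map (of e.2.2)
  have hφ : U ⋙ φ.toFunctor = toVertexGroup r := by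
    apply ext_functor
    intro a b e
    change φ (U.map (of e)) = _
    rw [hU]
    exact FreeGroup.lift_apply_of
  let ψ : End r →* FreeGroup E :=
    { toFun g := U.map g
      map_one' := U.map_id r
      map_mul' g k := U.map_comp k g }
  have hψ : Function.Injective ψ := by
    intro g k h
    apply toVertexGroup_map_injective r
    have h' : (U ⋙ φ.toFunctor).map g = (U ⋙ φ.toFunctor).map k := congrArg φ h
    rwa [hφ] at h'
  exact IsFreeGroup.ofMulEquiv (MonoidHom.ofInjective hψ).symm

/-- A skeletal groupoid all of whose vertex groups are free is free. -/
theorem nonempty_of_skeletal (hG : Skeletal G) (h : ∀ r : G, IsFreeGroup (End r)) :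
    Nonempty (IsFreeGroupoid G) := by
  refine ⟨{
    quiverGenerators := ⟨fun a b : G => {_x : IsFreeGroup.Generators (End a) // a = b}⟩
    of := fun {a b} e => (IsFreeGroup.of e.1 : End (show G from a)) ≫ eqToHom e.2
    unique_lift := ?_ }⟩
  intro X _ f
  let φ (a : G) : End a →* X := IsFreeGroup.lift fun x => f (a := a) (b := a) ⟨x, rfl⟩
  have eq_of_hom {a b : G} (g : a ⟶ b) : a = b := hG ⟨Groupoid.isoEquivHom _ _ |>.symm g⟩
  refine ⟨{
    obj := fun _ => SingleObj.star X
    map := fun {a b} g => φ a (g ≫ eqToHom (eq_of_hom g).symm : a ⟶ a)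
    map_id := ?_
    map_comp := ?_ }, ?_, ?_⟩
  · intro a
    rw [eqToHom_refl, Category.comp_id]
    exact (φ a).map_one
  · intro a b c g k
    obtain rfl := eq_of_hom g
    obtain rfl := eq_of_hom k
    simp only [eqToHom_refl, Category.comp_id]
    exact (φ a).map_mul k g
  · rintro a b ⟨x, h⟩
    cases h
    refine (congrArg (φ a) ?_).trans (IsFreeGroup.lift_of (G := End (show G from a)) _ x)
    exact (Category.comp_id _).trans (Category.comp_id _)
  · intro E hE
    refine CategoryTheory.Functor.ext (fun _ => rfl) ?_
    intro a b g
    obtain rfl := eq_of_hom g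
    simp only [eqToHom_refl, Category.comp_id, Category.id_comp]
    let ε : End a →* X :=
      { toFun g := E.map g
        map_one' := E.map_id a
        map_mul' g k := E.map_comp k g }
    suffices ε = φ a from DFunLike.congr_fun this g
    apply IsFreeGroup.ext_hom
    intro x
    refine Eq.trans ?_ (IsFreeGroup.lift_of _ x).symm
    refine Eq.trans ?_ (hE a a ⟨x, rfl⟩)
    exact congrArg E.map (Category.comp_id _).symm

end VertexGroup

section Extension

variable {C D : Type u} [Groupoid.{u} C] [Groupoid.{u} D]

/-- The generators of `D`, together with an arrow `t c` for each object `c` of `C` outside the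
image of `D`. -/
inductive ExtensionHom [IsFreeGroupoid D] (I : D ⥤ C) (t : ∀ c, Σ d, (I.obj d ⟶ c)) :
    C → C → Type u
  | base {d d' : Generators D} (e : d ⟶ d') : ExtensionHom I t (I.obj d) (I.obj d')
  | leg (c : C) (h : c ∉ Set.range I.obj) : ExtensionHom I t (I.obj (t c).1) c

/-- The arrow of `C` underlying a generator. -/
def ExtensionHom.toHom [IsFreeGroupoid D] {I : D ⥤ C} {t : ∀ c, Σ d, (I.obj d ⟶ c)} :
    ∀ {a b : C}, ExtensionHom I t a b → (a ⟶ b)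
  | _, _, .base e => I.map (of e)
  | _, _, .leg c _ => (t c).2

theorem exists_section_of_injective (I : D ⥤ C) [I.EssSurj] (hI : Function.Injective I.obj) :
    ∃ t : ∀ c, Σ d, (I.obj d ⟶ c), ∀ d, t (I.obj d) = ⟨d, 𝟙 _⟩ := by
  classical
  refine ⟨fun c => if h : ∃ d, I.obj d = c then ⟨h.choose, eqToHom h.choose_spec⟩
    else ⟨I.objPreimage c, (I.objObjPreimageIso c).hom⟩, fun d => ?_⟩
  have h : ∃ d', I.obj d' = I.obj d := ⟨d, rfl⟩
  have key (d' : D) (h' : I.obj d' = I.obj d) :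
      (⟨d', eqToHom h'⟩ : Σ d', (I.obj d' ⟶ I.obj d)) = ⟨d, 𝟙 _⟩ := by
    obtain rfl := hI h'
    rfl
  exact (dif_pos h).trans (key _ _)

/-- A groupoid containing, injectively on objects, an equivalent free groupoid is free. -/
theorem nonempty_of_isEquivalence [IsFreeGroupoid D] (I : D ⥤ C) [I.IsEquivalence]
    (hI : Function.Injective I.obj) : Nonempty (IsFreeGroupoid C) := by
  classical
  obtain ⟨t, ht⟩ := exists_section_of_injective I hI
  refine ⟨{
    quiverGenerators := ⟨fun a b : C => ExtensionHom I t a b⟩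
    of := fun e => ExtensionHom.toHom e
    unique_lift := ?_ }⟩
  intro X _ f
  obtain ⟨F, hF, -⟩ := unique_lift (G := D) (X := X)
    (fun d d' e => f (a := I.obj d) (b := I.obj d') (.base e))
  let y (c : C) : X :=
    if h : c ∈ Set.range I.obj then 1 else f (a := I.obj (t c).1) (b := c) (.leg c h)
  have hy (d : D) : y (I.obj d) = 1 := dif_pos ⟨d, rfl⟩
  let pull {a b : C} (g : a ⟶ b) : (t a).1 ⟶ (t b).1 :=
    I.preimage ((t a).2 ≫ g ≫ Groupoid.inv (t b).2)
  have pull_id (a : C) : pull (𝟙 a) = 𝟙 _ := I.map_injective (by simp [pull])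
  have pull_comp {a b c : C} (g : a ⟶ b) (k : b ⟶ c) : pull (g ≫ k) = pull g ≫ pull k :=
    I.map_injective (by simp [pull])
  let L {a b : C} (g : a ⟶ b) : X := y b * (F.map (pull g) : X) * (y a)⁻¹
  have L_map {d d' : D} (h : d ⟶ d') : L (I.map h) = F.map h := by
    have key (x : Σ e, (I.obj e ⟶ I.obj d)) (x' : Σ e, (I.obj e ⟶ I.obj d'))
        (hx : x = ⟨d, 𝟙 _⟩) (hx' : x' = ⟨d', 𝟙 _⟩) :
        (F.map (I.preimage (x.2 ≫ I.map h ≫ Groupoid.inv x'.2)) : X) = F.map h := by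
      subst hx hx'
      congr 1
      exact I.map_injective (by simp)
    simp only [L, hy, one_mul, inv_one, mul_one]
    exact key _ _ (ht d) (ht d')
  have L_leg (c : C) : L (t c).2 = y c := by
    have key (x : Σ e, (I.obj e ⟶ I.obj (t c).1)) (hx : x = ⟨_, 𝟙 _⟩) :
        (F.map (I.preimage (x.2 ≫ (t c).2 ≫ Groupoid.inv (t c).2)) : X) = 1 := by
      subst hx
      refine Eq.trans ?_ (F.map_id _)
      congr 1
      exact I.map_injective (by simp)
    simp only [L, hy, inv_one, mul_one]
    exact (congrArg (y c * ·) (key _ (ht _))).trans (mul_one _)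
  refine existsUnique_of_exists_of_unique ⟨{
    obj := fun _ => SingleObj.star X
    map := fun g => L g
    map_id := ?_
    map_comp := ?_ }, ?_⟩ ?_
  · intro a
    simp only [L, pull_id, F.map_id, SingleObj.id_as_one]
    exact (congrArg (· * (y a)⁻¹) (mul_one _)).trans (mul_inv_cancel _)
  · intro a b c g k
    simp only [L, pull_comp, F.map_comp, SingleObj.comp_as_mul]
    group
  · rintro a b (e | ⟨_, h⟩)
    · exact (L_map _).trans (hF _ _ e)
    · exact (L_leg _).trans (dif_neg h)
  · intro E E' hE hE'
    have base : I ⋙ E = I ⋙ E' := by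
      apply ext_functor
      intro d d' e
      exact (hE _ _ (.base e)).trans (hE' _ _ (.base e)).symm
    have leg (c : C) : (E.map (t c).2 : X) = E'.map (t c).2 := by
      by_cases h : c ∈ Set.range I.obj
      · obtain ⟨d, rfl⟩ := h
        rw [ht]
        exact (E.map_id _).trans (E'.map_id _).symm
      · exact (hE _ _ (.leg c h)).trans (hE' _ _ (.leg c h)).symm
    refine CategoryTheory.Functor.ext (fun _ => rfl) ?_
    intro a b g
    simp only [eqToHom_refl, Category.comp_id, Category.id_comp]
    have hg : (t a).2 ≫ g = I.map (pull g) ≫ (t b).2 := by simp [pull]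
    have hb : (E.map (I.map (pull g)) : X) = E'.map (I.map (pull g)) :=
      eq_of_heq (Functor.hcongr_hom base (pull g))
    have h₁ : (E.map g : X) * E.map (t a).2 = E.map (t b).2 * E.map (I.map (pull g)) :=
      (E.map_comp _ _).symm.trans ((congrArg E.map hg).trans (E.map_comp _ _))
    have h₂ : (E'.map g : X) * E'.map (t a).2 = E'.map (t b).2 * E'.map (I.map (pull g)) :=
      (E'.map_comp _ _).symm.trans ((congrArg E'.map hg).trans (E'.map_comp _ _))
    rw [leg, leg, hb, ← h₂] at h₁
    exact mul_right_cancel h₁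

end Extension

end IsFreeGroupoid

/-- A small groupoid is free if and only if its skeleton is free. -/
theorem isFreeGroupoid_iff_skeleton_isFreeGroupoid (G : Type u) [Groupoid.{u} G] :
    Nonempty (IsFreeGroupoid G) ↔ Nonempty (IsFreeGroupoid (Skeleton G)) := by
  constructor
  · rintro ⟨_⟩
    refine IsFreeGroupoid.nonempty_of_skeletal (skeleton_isSkeleton G).skel fun r => ?_
    have := IsFreeGroupoid.isFreeGroup_end ((fromSkeleton G).obj r)
    exact IsFreeGroup.ofMulEquiv
      ((Functor.FullyFaithful.ofFullyFaithful (fromSkeleton G)).mulEquivEnd r).symm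
  · rintro ⟨_⟩
    exact @IsFreeGroupoid.nonempty_of_isEquivalence _ _ _ _ _ (fromSkeleton G)
      (skeleton_isSkeleton G).eqv fun _ _ h => Quotient.out_injective h
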